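/- For every integer n ≥ 1 and every preference list α = (a_1,…,a_n) ∈ [n]^n, α is an MVP parking function of length n if and only if for every i ∈ [n] the number of indices j ∈ [n] with a_j ≤ i is at least i (equivalently, the nondecreasing rearrangement b_1 ≤ b_2 ≤ ⋯ ≤ b_n of α satisfies b_i ≤ i for all i ∈ [n]). -/

import Mathlib

open Finset

namespace MVPPark

/-- One step of the MVP parking process: car `c`, preferring spot `p`, arrives at the
state `state` (recording, for each spot, the car parked there, if any).  Car `c` always
parks in spot `p`; if spot `p` was occupied by an (earlier) car `j`, then `j` is bumped
and parks in the first unoccupied spot strictly beyond `p`, if such a spot exists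
(otherwise `j` drives off unparked). -/
def mvpStep {n : ℕ} (state : Fin n → Option (Fin n)) (c p : Fin n) :
    Fin n → Option (Fin n) :=
  match state p with
  | none => Function.update state p (some c)
  | some j =>
    match (List.finRange n).find? (fun k => decide (p < k) && (state k).isNone) with
    | none => Function.update state p (some c)
    | some k => Function.update (Function.update state p (some c)) k (some j)

/-- The final state of the MVP parking process with preference list `α`:
cars `0, 1, …, n-1` enter in order, car `i` preferring spot `α i`. -/
def mvpRun {n : ℕ} (α : Fin n → Fin n) : Fin n → Option (Fin n) :=
  (List.finRange n).foldl (fun st c => mvpStep st c (α c)) (fun _ => none)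

/-- `α` is an MVP parking function: under the MVP rule, all `n` cars end up parked. -/
def IsMVP {n : ℕ} (α : Fin n → Fin n) : Prop :=
  ∀ c : Fin n, ∃ j : Fin n, mvpRun α j = some c

/-- The outcome of the MVP parking process on `α` is the permutation `π`:
for each `j`, spot `j` ends up occupied by car `π j`. -/
def MvpOutcome {n : ℕ} (α : Fin n → Fin n) (π : Equiv.Perm (Fin n)) : Prop :=
  ∀ j : Fin n, mvpRun α j = some (π j)

end MVPPark

namespace MVPPark

/-- The properties of the street that hold after exactly the cars in `l` have entered. -/
structure StreetInvariant {n : ℕ} (α : Fin n → Fin n) (l : List (Fin n))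
    (st : Fin n → Option (Fin n)) : Prop where
  mem_of_parked : ∀ k c, st k = some c → c ∈ l
  spot_unique : ∀ k k' c, st k = some c → st k' = some c → k = k'
  pref_le_spot : ∀ k c, st k = some c → α c ≤ k
  parked_before_empty : ∀ c ∈ l, ∀ i, st i = none → α c ≤ i → ∃ k < i, st k = some c

theorem mvpStep_cases {n : ℕ} (st : Fin n → Option (Fin n)) (c p : Fin n) :
    (st p = none ∧ mvpStep st c p = Function.update st p (some c)) ∨
    (∃ j, st p = some j ∧ (∀ k, p < k → st k ≠ none) ∧
      mvpStep st c p = Function.update st p (some c)) ∨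
    (∃ j k, st p = some j ∧ p < k ∧ st k = none ∧ (∀ i, p < i → st i = none → k ≤ i) ∧
      mvpStep st c p = Function.update (Function.update st p (some c)) k (some j)) := by
  unfold mvpStep
  cases hp : st p with
  | none => simp
  | some j =>
    right
    cases hf : (List.finRange n).find? (fun k => decide (p < k) && (st k).isNone) with
    | none =>
      left
      simp only [List.find?_eq_none] at hf
      refine ⟨j, rfl, fun k hk h => ?_, rfl⟩
      exact hf k (List.mem_finRange k) (by simp [hk, h])
    | some k =>
      right
      have hk := List.find?_some hf
      simp only [Bool.and_eq_true, decide_eq_true_eq, Option.isNone_iff_eq_none] at hk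
      refine ⟨j, k, rfl, hk.1, hk.2, fun i hi h => ?_, rfl⟩
      by_contra! hlt
      obtain ⟨-, as, bs, hl, has⟩ := List.find?_eq_some_iff_append.1 hf
      have hsorted : (List.finRange n).Pairwise (· < ·) := List.pairwise_lt_finRange n
      have hmem := List.mem_finRange i
      rw [hl] at hmem hsorted
      have hcons := (List.pairwise_append.1 hsorted).2.1
      rw [List.pairwise_cons] at hcons
      rw [List.mem_append, List.mem_cons] at hmem
      rcases hmem with hm | rfl | hm
      · simpa [hi, h] using has i hm
      · exact lt_irrefl _ hlt
      · exact lt_asymm hlt (hcons.1 i hm)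

theorem StreetInvariant.step {n : ℕ} {α : Fin n → Fin n} {l : List (Fin n)}
    {st : Fin n → Option (Fin n)} (h : StreetInvariant α l st) {c : Fin n} (hc : c ∉ l) :
    StreetInvariant α (l ++ [c]) (mvpStep st c (α c)) := by
  obtain ⟨h1, h2, h3, h4⟩ := h
  rcases mvpStep_cases st c (α c) with
    ⟨hp, hs⟩ | ⟨j, hp, hfull, hs⟩ | ⟨j, m, hp, hpm, hm, hmin, hs⟩
  all_goals
    rw [hs]
    constructor
    · grind
    · grind
    · grind
    · intro d hd i hi hdi
      have hi' : st i = none ∧ i ≠ α c := by grind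
      by_cases hdc : d = c
      · subst hdc
        exact ⟨α d, by grind, by grind⟩
      · obtain ⟨k, hk, hkd⟩ := h4 d (by grind) i hi'.1 hdi
        by_cases hkc : k = α c
        · first
          | grind
          | exact ⟨m, by grind, by grind⟩
        · exact ⟨k, hk, by grind⟩

theorem streetInvariant_foldl {n : ℕ} (α : Fin n → Fin n) (l : List (Fin n)) (hl : l.Nodup) :
    StreetInvariant α l (l.foldl (fun st c => mvpStep st c (α c)) (fun _ => none)) := by
  induction l using List.reverseRecOn with
  | nil => constructor <;> simp
  | append_singleton l c ih =>
    rw [List.foldl_append]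
    rw [List.nodup_append] at hl
    exact (ih hl.1).step (by grind)

theorem streetInvariant_mvpRun {n : ℕ} (α : Fin n → Fin n) :
    StreetInvariant α (List.finRange n) (mvpRun α) :=
  streetInvariant_foldl α _ (List.nodup_finRange n)

theorem mvpRun_ne_none_of_counts {n : ℕ} {α : Fin n → Fin n} {i : Fin n}
    (h : i.1 + 1 ≤ (Finset.univ.filter (fun j : Fin n => α j ≤ i)).card) :
    mvpRun α i ≠ none := by
  intro hi
  choose! f hlt hf using fun c =>
    (streetInvariant_mvpRun α).parked_before_empty c (List.mem_finRange c) i hi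
  have hle : (Finset.univ.filter (fun j : Fin n => α j ≤ i)).card ≤ (Finset.Iio i).card := by
    refine Finset.card_le_card_of_injOn f (fun c hc => ?_) (fun c hc d hd hcd => ?_)
    · simpa using hlt c (by simpa using hc)
    · have hfc := hf c (by simpa using hc)
      have hfd := hf d (by simpa using hd)
      rw [hcd, hfd] at hfc
      exact (Option.some.inj hfc).symm
  rw [Fin.card_Iio] at hle
  omega

end MVPPark

open MVPPark in
/-- `α` is an MVP parking function iff for every spot `i`, at least `i` cars (in the
`1`-indexed count, i.e. at least `i.1 + 1` cars for `i : Fin n`) prefer a spot `≤ i`. -/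
theorem mvp_iff_counts (n : ℕ) (hn : 1 ≤ n) (α : Fin n → Fin n) :
    IsMVP α ↔
      ∀ i : Fin n, i.1 + 1 ≤ (Finset.univ.filter (fun j : Fin n => α j ≤ i)).card := by
  constructor
  · intro h i
    choose f hf using h
    have hinj : Function.Injective f := fun c d hcd => by
      have hfc := hf c
      rw [hcd, hf d] at hfc
      exact (Option.some.inj hfc).symm
    have hsurj : Function.Surjective f := Finite.surjective_of_injective hinj
    rw [← Fin.card_Iic]
    refine Finset.card_le_card_of_surjOn f fun k hk => ?_
    obtain ⟨c, rfl⟩ := hsurj k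
    have hpref := (streetInvariant_mvpRun α).pref_le_spot _ c (hf c)
    exact ⟨c, by simpa using hpref.trans (by simpa using hk), rfl⟩
  · intro h c
    choose g hg using fun i => Option.ne_none_iff_exists'.1 (mvpRun_ne_none_of_counts (h i))
    have hinj : Function.Injective g := fun i j hij =>
      (streetInvariant_mvpRun α).spot_unique i j (g i) (hg i) (hij ▸ hg j)
    obtain ⟨i, rfl⟩ := Finite.surjective_of_injective hinj c
    exact ⟨i, hg i⟩
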